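/- For the hyperoctahedral group (Weyl group of type B_n), the number of good generating sets — sets of n reflections generating the whole group — equals (2n)^{n-1}. -/

import Mathlib

/-- `f` encodes a rooted forest on `U ∪ R` with set of roots `R`: it sends each vertex of `U` to
its parent, there are no cycles in `U`, and vertices outside `U` are fixed. -/
def IsRootedForest {V : Type*} [DecidableEq V] (R U : Finset V) (f : V → V) : Prop :=
  (∀ v, v ∉ U → f v = v) ∧ (∀ v ∈ U, f v ∈ U ∪ R) ∧
    ∀ X ⊆ U, X.Nonempty → ∃ v ∈ X, f v ∉ X

namespace IsRootedForest

variable {V : Type*} [DecidableEq V] {R U J : Finset V} {f : V → V}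

lemma restrict (hf : IsRootedForest R U f) (hJ : U.filter (fun v => f v ∈ R) = J) :
    IsRootedForest J (U \ J) (fun v => if v ∈ U \ J then f v else v) := by
  subst hJ
  refine ⟨fun v hv => if_neg hv, fun v hv => ?_, fun X hX hne => ?_⟩
  · have h1 := hf.2.1 v (Finset.mem_sdiff.1 hv).1
    simp only [hv, if_true]
    simp only [Finset.mem_sdiff, Finset.mem_filter, Finset.mem_union] at hv h1 ⊢
    tauto
  · obtain ⟨v, hv, hfv⟩ := hf.2.2 X (hX.trans Finset.sdiff_subset) hne
    exact ⟨v, hv, by simpa only [hX hv, if_true] using hfv⟩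

lemma extend (hRU : Disjoint R U) (hJ : J ⊆ U) {g : V → V}
    (hg : IsRootedForest J (U \ J) g) (h : J → R) :
    IsRootedForest R U (fun v => if hv : v ∈ J then (h ⟨v, hv⟩ : V) else g v) := by
  refine ⟨fun v hv => ?_, fun v hv => ?_, fun X hX hne => ?_⟩
  · have : v ∉ J := fun h => hv (hJ h)
    simp [this, hg.1 v (by simp [hv])]
  · by_cases hvJ : v ∈ J
    · simp [hvJ]
    · have h1 := hg.2.1 v (by simp [hv, hvJ])
      simp only [Finset.mem_sdiff, Finset.mem_union] at h1
      simp only [hvJ, dite_false, Finset.mem_union]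
      rcases h1 with h1 | h1
      · exact Or.inl h1.1
      · exact Or.inl (hJ h1)
  · by_cases hXJ : ∃ v ∈ X, v ∈ J
    · obtain ⟨v, hv, hvJ⟩ := hXJ
      refine ⟨v, hv, fun hmem => ?_⟩
      simp only [hvJ, dite_true] at hmem
      exact Finset.disjoint_left.1 hRU (h ⟨v, hvJ⟩).2 (hX hmem)
    · push Not at hXJ
      obtain ⟨v, hv, hgv⟩ := hg.2.2 X (fun v hv => by simp [hX hv, hXJ v hv]) hne
      exact ⟨v, hv, by simpa [hXJ v hv] using hgv⟩

/-- Forests rooted at `R` in which `J` is the set of children of the roots. -/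
def fiberEquiv (hRU : Disjoint R U) (hJ : J ⊆ U) :
    {f : V → V // IsRootedForest R U f ∧ U.filter (fun v => f v ∈ R) = J} ≃
      (J → R) × {g : V → V // IsRootedForest J (U \ J) g} where
  toFun f := (fun v => ⟨f.1 v, by
      exact (Finset.mem_filter.1 (f.2.2.symm.subset v.2)).2⟩, ⟨_, f.2.1.restrict f.2.2⟩)
  invFun p := ⟨_, p.2.2.extend hRU hJ p.1, by
    ext v
    by_cases hvJ : v ∈ J
    · simp [hvJ, hJ hvJ]
    · simp only [Finset.mem_filter, hvJ, dite_false, iff_false, not_and]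
      intro hv hR
      have h1 := p.2.2.2.1 v (by simp [hv, hvJ])
      simp only [Finset.mem_sdiff, Finset.mem_union] at h1
      rcases h1 with h1 | h1
      · exact Finset.disjoint_left.1 hRU hR h1.1
      · exact Finset.disjoint_left.1 hRU hR (hJ h1)⟩
  left_inv f := by
    ext v
    by_cases hvJ : v ∈ J
    · simp [hvJ]
    · by_cases hv : v ∈ U
      · simp [hvJ, hv]
      · simp [hvJ, hv, f.2.1.1 v hv]
  right_inv p := by
    refine Prod.ext ?_ (Subtype.ext ?_)
    · ext v
      simp
    · ext v
      by_cases hvJ : v ∈ J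
      · simp [hvJ, p.2.2.1 v (by simp [hvJ])]
      · by_cases hv : v ∈ U
        · simp [hvJ, hv]
        · simp [hvJ, hv, p.2.2.1 v (by simp [hv])]

lemma card_eq_sum [Fintype V] (hRU : Disjoint R U) :
    Nat.card {f : V → V // IsRootedForest R U f} =
      ∑ J ∈ U.powerset, R.card ^ J.card *
        Nat.card {g : V → V // IsRootedForest J (U \ J) g} := by
  classical
  rw [Nat.card_eq_fintype_card, Fintype.card_subtype,
    Finset.card_eq_sum_card_fiberwise (f := fun f => U.filter (fun v => f v ∈ R))
      (t := U.powerset) (fun f _ =>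
        Finset.mem_coe.2 (Finset.mem_powerset.2 (Finset.filter_subset _ _)))]
  refine Finset.sum_congr rfl fun J hJ => ?_
  rw [Finset.filter_filter, ← Fintype.card_subtype, ← Nat.card_eq_fintype_card,
    Nat.card_congr (fiberEquiv hRU (Finset.mem_powerset.1 hJ)), Nat.card_prod]
  simp

lemma sum_choose_mul_pow (r u : ℕ) :
    ∑ j ∈ Finset.range (u + 2), (u + 1).choose j * (r ^ j * (j * (u + 1) ^ (u + 1 - j))) =
      (u + 1) * (r * (u + 1 + r) ^ u) := by
  rw [Finset.sum_range_succ', add_comm (u + 1) r, add_pow r, Finset.mul_sum, Finset.mul_sum]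
  simp only [zero_mul, mul_zero, add_zero]
  refine Finset.sum_congr rfl fun j _ => ?_
  have := Nat.add_one_mul_choose_eq u j
  rw [Nat.add_sub_add_right]
  calc _ = ((u + 1).choose (j + 1) * (j + 1)) * (r ^ (j + 1) * (u + 1) ^ (u - j)) := by ring
    _ = _ := by rw [← this, Nat.cast_id]; ring

theorem card_mul [Fintype V] (hRU : Disjoint R U) :
    (U.card + R.card) * Nat.card {f : V → V // IsRootedForest R U f} =
      R.card * (U.card + R.card) ^ U.card := by
  induction hu : U.card using Nat.strong_induction_on generalizing R U with
  | _ u ih =>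
  rcases u with _ | u
  · obtain rfl := Finset.card_eq_zero.1 hu
    have : Nat.card {f : V → V // IsRootedForest R ∅ f} = 1 := by
      rw [Nat.card_eq_one_iff_exists]
      refine ⟨⟨id, fun _ _ => rfl, by simp, fun X hX hne => ?_⟩, fun g => ?_⟩
      · simp [Finset.subset_empty.1 hX] at hne
      · ext v
        exact g.2.1 v (by simp)
    simp [this]
  · have key : (u + 1) * Nat.card {f : V → V // IsRootedForest R U f} =
        (u + 1) * (R.card * (u + 1 + R.card) ^ u) := by
      rw [card_eq_sum hRU, Finset.mul_sum, ← sum_choose_mul_pow]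
      have h2 : ∀ J ∈ U.powerset, (u + 1) * (R.card ^ J.card *
          Nat.card {g : V → V // IsRootedForest J (U \ J) g}) =
          R.card ^ J.card * (J.card * (u + 1) ^ (u + 1 - J.card)) := by
        intro J hJ
        have hJU := Finset.mem_powerset.1 hJ
        rcases J.eq_empty_or_nonempty with rfl | hne
        · have : IsEmpty {g : V → V // IsRootedForest ∅ (U \ ∅) g} := by
            refine ⟨fun g => ?_⟩
            obtain ⟨v, hv, hgv⟩ := g.2.2.2 (U \ ∅) subset_rfl
              (by rw [Finset.sdiff_empty, ← Finset.card_pos]; omega)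
            exact hgv (by simpa using g.2.2.1 v hv)
          rw [Nat.card_of_isEmpty]
          simp
        · have hc : (U \ J).card = u + 1 - J.card := by rw [Finset.card_sdiff_of_subset hJU, hu]
          have hpos := hne.card_pos
          have hle := Finset.card_le_card hJU
          have := ih (U \ J).card (by omega) (R := J) Finset.disjoint_sdiff rfl
          rw [hc, show u + 1 - J.card + J.card = u + 1 by omega] at this
          rw [← this]
          ring
      rw [Finset.sum_congr rfl h2, Finset.sum_powerset_apply_card
        (fun j => R.card ^ j * (j * (u + 1) ^ (u + 1 - j))), hu]
      simp
    rw [Nat.eq_of_mul_eq_mul_left (Nat.succ_pos u) key]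
    ring

/-- Cayley's formula for trees with a given root. -/
theorem card_tree_mul [Fintype V] (r : V) :
    Fintype.card V * Nat.card {f : V → V // IsRootedForest {r} (Finset.univ.erase r) f} =
      Fintype.card V ^ (Fintype.card V - 1) := by
  have hpos : 0 < Fintype.card V := Fintype.card_pos_iff.2 ⟨r⟩
  have := card_mul (R := {r}) (U := Finset.univ.erase r) (by simp)
  rwa [Finset.card_singleton, Finset.card_erase_of_mem (Finset.mem_univ r), Finset.card_univ,
    Nat.sub_add_cancel hpos, one_mul] at this

lemma apply_apply_ne (hf : IsRootedForest R U f) {v : V} (hv : v ∈ U) (hfv : f v ∈ U) :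
    f (f v) ≠ v := by
  intro h
  obtain ⟨x, hx, hfx⟩ := hf.2.2 {v, f v} (by simp [Finset.insert_subset_iff, hv, hfv]) (by simp)
  simp only [Finset.mem_insert, Finset.mem_singleton, not_or] at hx hfx
  rcases hx with rfl | rfl
  · exact hfx.2 rfl
  · exact hfx.1 h

lemma apply_ne (hf : IsRootedForest R U f) {v : V} (hv : v ∈ U) : f v ≠ v := by
  obtain ⟨x, hx, hfx⟩ := hf.2.2 {v} (by simpa) (by simp)
  simp only [Finset.mem_singleton] at hx hfx
  exact hx ▸ hfx

end IsRootedForest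

section CosetEnumeration

variable {W : Type*} [Group W]

/-- The braid relations of type `B`, where the generator `s 0` sits at the end of the double bond
and only the generators `s i` with `i < n` are considered. -/
structure BraidRelationsB (n : ℕ) (s : ℕ → W) : Prop where
  sq : ∀ i, i < n → s i * s i = 1
  comm : ∀ i j, i + 2 ≤ j → j < n → s i * s j = s j * s i
  braid : ∀ i, i + 2 < n → s (i + 1) * s (i + 2) * s (i + 1) = s (i + 2) * s (i + 1) * s (i + 2)
  braid_four : 1 < n → s 0 * s 1 * s 0 * s 1 = s 1 * s 0 * s 1 * s 0

/-- The word `s (j + 1) * s (j + 2) * ⋯ * s (j + l)`. -/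
def ascendingProd (s : ℕ → W) : ℕ → ℕ → W
  | _, 0 => 1
  | j, l + 1 => s (j + 1) * ascendingProd s (j + 1) l

/-- The conjugate of `s 0` by `s j * ⋯ * s 1`. -/
def signReflection (s : ℕ → W) : ℕ → W
  | 0 => s 0
  | j + 1 => s (j + 1) * signReflection s j * s (j + 1)

namespace BraidRelationsB

variable {n : ℕ} {s : ℕ → W} (h : BraidRelationsB n s)
include h

lemma mul_ascendingProd_of_lt {i j l : ℕ} (hij : i < j) (hl : j + l < n) :
    s i * ascendingProd s j l = ascendingProd s j l * s i := by
  induction l generalizing j with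
  | zero => simp [ascendingProd]
  | succ l ih =>
    rw [ascendingProd, ← mul_assoc, h.comm i (j + 1) (by omega) (by omega), mul_assoc,
      ih (by omega) (by omega), mul_assoc]

lemma mul_ascendingProd {i j l : ℕ} (hij : j + 1 ≤ i) (hi : i + 1 ≤ j + l) (hl : j + l < n) :
    s (i + 1) * ascendingProd s j l = ascendingProd s j l * s i := by
  induction l generalizing j with
  | zero => omega
  | succ l ih =>
    rw [ascendingProd, ← mul_assoc]
    rcases Nat.eq_or_lt_of_le hij with rfl | hij
    · obtain ⟨l, rfl⟩ : ∃ m, l = m + 1 := ⟨l - 1, by omega⟩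
      rw [ascendingProd, ← mul_assoc, ← h.braid j (by omega), mul_assoc _ (s (j + 1)),
        h.mul_ascendingProd_of_lt (by omega) (by omega)]
      simp only [mul_assoc]
    · rw [← h.comm (j + 1) (i + 1) (by omega) (by omega), mul_assoc,
        ih (by omega) (by omega) (by omega), mul_assoc]

lemma signReflection_comm_of_lt {i j : ℕ} (hij : j + 1 < i) (hi : i < n) :
    s i * signReflection s j = signReflection s j * s i := by
  induction j with
  | zero => exact (h.comm 0 i (by omega) hi).symm
  | succ j ih =>
    have h1 := h.comm (j + 1) i (by omega) hi
    rw [signReflection, ← mul_assoc, ← mul_assoc, ← h1, mul_assoc _ (s i), ih (by omega)]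
    simp only [mul_assoc, h1]

lemma signReflection_comm {i j : ℕ} (hij : i < j) (hj : j < n) :
    s i * signReflection s j = signReflection s j * s i := by
  induction j with
  | zero => omega
  | succ j ih =>
    rcases Nat.eq_or_lt_of_le (Nat.le_of_lt_succ hij) with rfl | hij
    · rcases i with _ | i
      · have := h.braid_four hj
        simp only [signReflection, zero_add, ← mul_assoc]
        exact this
      · have hb := h.braid i hj
        have hc := h.signReflection_comm_of_lt (i := i + 2) (j := i) (by omega) hj
        simp only [signReflection]
        calc _ = (s (i + 1) * s (i + 2) * s (i + 1)) * signReflection s i * s (i + 1) *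
              s (i + 2) := by simp only [mul_assoc]
          _ = s (i + 2) * s (i + 1) * (s (i + 2) * signReflection s i) * s (i + 1) *
              s (i + 2) := by rw [hb]; simp only [mul_assoc]
          _ = s (i + 2) * s (i + 1) * signReflection s i * (s (i + 2) * s (i + 1) *
              s (i + 2)) := by rw [hc]; simp only [mul_assoc]
          _ = _ := by rw [← hb]; simp only [mul_assoc]
    · have h1 := h.comm i (j + 1) (by omega) (by omega)
      rw [signReflection, ← mul_assoc, ← mul_assoc, h1, mul_assoc _ (s i), ih hij (by omega)]
      simp only [mul_assoc, h1]

lemma mul_self_mul {i : ℕ} (hi : i < n) (w : W) : s i * (s i * w) = w := by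
  rw [← mul_assoc, h.sq i hi, one_mul]

lemma exists_mul_ascendingProd {i j k : ℕ} (hj : j ≤ k) (hk : k < n) (hi : i ≤ k)
    (hij : i ≠ j) (hij' : i ≠ j + 1) :
    ∃ g ∈ Subgroup.closure (s '' Set.Iio k),
      s i * ascendingProd s j (k - j) = ascendingProd s j (k - j) * g := by
  rcases Nat.lt_or_ge i j with hlt | hge
  · exact ⟨s i, Subgroup.subset_closure ⟨i, by simp; omega, rfl⟩,
      h.mul_ascendingProd_of_lt hlt (by omega)⟩
  · obtain ⟨i, rfl⟩ : ∃ m, i = m + 1 := ⟨i - 1, by omega⟩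
    exact ⟨s i, Subgroup.subset_closure ⟨i, by simp; omega, rfl⟩,
      h.mul_ascendingProd (by omega) (by omega) (by omega)⟩

lemma mem_cosets {k : ℕ} (hk : k < n) {w : W}
    (hw : w ∈ Subgroup.closure (s '' Set.Iio (k + 1))) :
    ∃ j ≤ k, ∃ g ∈ Subgroup.closure (s '' Set.Iio k),
      w = ascendingProd s j (k - j) * g ∨
      w = signReflection s j * (ascendingProd s j (k - j) * g) := by
  have step : ∀ i ≤ k, ∀ w, (∃ j ≤ k, ∃ g ∈ Subgroup.closure (s '' Set.Iio k),
      w = ascendingProd s j (k - j) * g ∨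
      w = signReflection s j * (ascendingProd s j (k - j) * g)) →
      (∃ j ≤ k, ∃ g ∈ Subgroup.closure (s '' Set.Iio k),
      s i * w = ascendingProd s j (k - j) * g ∨
      s i * w = signReflection s j * (ascendingProd s j (k - j) * g)) := by
    rintro i hi w ⟨j, hj, g, hg, hw⟩
    by_cases hij' : i = j + 1
    · subst hij'
      have hkj : k - j = k - (j + 1) + 1 := by omega
      refine ⟨j + 1, hi, g, hg, hw.imp ?_ ?_⟩
      · rintro rfl
        rw [hkj, ascendingProd, mul_assoc, h.mul_self_mul (by omega)]
      · rintro rfl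
        rw [hkj, ascendingProd, signReflection]
        simp only [mul_assoc]
    by_cases hij : i = j
    · subst hij
      rcases i with _ | j
      · refine ⟨0, hj, g, hg, ?_⟩
        rcases hw with rfl | rfl
        · exact Or.inr rfl
        · exact Or.inl (h.mul_self_mul (by omega) _)
      · have hkj : k - j = k - (j + 1) + 1 := by omega
        refine ⟨j, by omega, g, hg, hw.imp ?_ ?_⟩
        · rintro rfl
          rw [hkj, ascendingProd, mul_assoc]
        · rintro rfl
          rw [hkj, ascendingProd, signReflection]
          simp only [mul_assoc]
          rw [h.mul_self_mul (by omega)]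
    · obtain ⟨g', hg', he⟩ := h.exists_mul_ascendingProd hj hk hi hij hij'
      refine ⟨j, hj, g' * g, mul_mem hg' hg, hw.imp ?_ ?_⟩
      · rintro rfl
        rw [← mul_assoc, he, mul_assoc]
      · rintro rfl
        have hc : s i * signReflection s j = signReflection s j * s i := by
          rcases Nat.lt_or_ge i j with hlt | hge
          · exact h.signReflection_comm hlt (by omega)
          · exact h.signReflection_comm_of_lt (by omega) (by omega)
        rw [← mul_assoc, hc, mul_assoc, ← mul_assoc (s i), he, mul_assoc]
  induction hw using Subgroup.closure_induction_left with
  | one => exact ⟨k, le_rfl, 1, one_mem _, Or.inl (by simp [ascendingProd])⟩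
  | mul_left x hx y _ ih =>
    obtain ⟨i, hi, rfl⟩ := hx
    exact step i (Nat.lt_succ_iff.1 hi) y ih
  | inv_mul_cancel x hx y _ ih =>
    obtain ⟨i, hi, rfl⟩ := hx
    have hi' : i ≤ k := Nat.lt_succ_iff.1 hi
    rw [inv_eq_of_mul_eq_one_left (h.sq i (by omega))]
    exact step i hi' y ih

/-- A homomorphism out of a group satisfying the braid relations of type `B` is injective as soon
as the generators act on some signed points `e j`, `e' j` like the standard generators of the
hyperoctahedral group. -/
theorem injective_of_action {G X : Type*} [Group G] [MulAction G X] (φ : W →* G)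
    (hgen : Subgroup.closure (s '' Set.Iio n) = ⊤) {e e' : ℕ → X}
    (he0 : φ (s 0) • e 0 = e' 0)
    (he : ∀ i, i + 1 < n → φ (s (i + 1)) • e (i + 1) = e i)
    (he' : ∀ i, i + 1 < n → φ (s (i + 1)) • e' i = e' (i + 1))
    (hfix : ∀ i k, i < k → k < n → φ (s i) • e k = e k)
    (hinj : ∀ j k, j < n → k < n → e j = e k → j = k)
    (hne : ∀ j k, j < n → k < n → e' j ≠ e k) : Function.Injective φ := by
  have hA : ∀ l j, j + l < n → φ (ascendingProd s j l) • e (j + l) = e j := by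
    intro l
    induction l with
    | zero => simp [ascendingProd]
    | succ l ih =>
      intro j hj
      rw [ascendingProd, map_mul, mul_smul, show j + (l + 1) = j + 1 + l by omega,
        ih _ (by omega), he j (by omega)]
  have hS : ∀ j, j < n → φ (signReflection s j) • e j = e' j := by
    intro j
    induction j with
    | zero => exact fun _ => he0
    | succ j ih =>
      intro hj
      rw [signReflection, map_mul, map_mul, mul_smul, mul_smul, he j hj, ih (by omega), he' j hj]
  have hH : ∀ k < n, ∀ g ∈ Subgroup.closure (s '' Set.Iio k), φ g • e k = e k := by
    intro k hk g hg
    have : Subgroup.closure (s '' Set.Iio k) ≤ (MulAction.stabilizer G (e k)).comap φ := by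
      rw [Subgroup.closure_le]
      rintro _ ⟨i, hi, rfl⟩
      exact hfix i k hi hk
    exact this hg
  have main : ∀ k ≤ n, ∀ w ∈ Subgroup.closure (s '' Set.Iio k), φ w = 1 → w = 1 := by
    intro k
    induction k with
    | zero => simp
    | succ k ih =>
      intro hk w hw hφ
      obtain ⟨j, hj, g, hg, hw'⟩ := h.mem_cosets (by omega) hw
      have h1 : φ (ascendingProd s j (k - j) * g) • e k = e j := by
        rw [map_mul, mul_smul, hH k (by omega) g hg]
        have := hA (k - j) j (by omega)
        rwa [Nat.add_sub_cancel' hj] at this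
      have h2 : φ w • e k = e k := by rw [hφ, one_smul]
      rcases hw' with rfl | rfl
      · obtain rfl := hinj j k (by omega) (by omega) (h1.symm.trans h2)
        simp only [Nat.sub_self, ascendingProd, one_mul] at hφ ⊢
        exact ih (by omega) g hg hφ
      · rw [map_mul, mul_smul, h1, hS j (by omega)] at h2
        exact absurd h2 (hne j k (by omega) (by omega))
  rw [injective_iff_map_eq_one]
  exact fun w hw => main n le_rfl w (hgen ▸ Subgroup.mem_top w) hw

end BraidRelationsB

end CosetEnumeration

/-- The hyperoctahedral group of signed permutations of `V`. -/
abbrev SignedPerm (V : Type*) : Type _ := (V → ℤˣ) ⋊[mulAutArrow] Equiv.Perm V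

namespace SignedPerm

open Equiv

variable {V : Type*}

lemma mul_left_apply (g h : SignedPerm V) (v : V) :
    (g * h).left v = g.left v * h.left (g.right⁻¹ v) := rfl

/-- The action of signed permutations on signed points. -/
instance : MulAction (SignedPerm V) (V × ℤˣ) where
  smul g p := (g.right p.1, g.left (g.right p.1) * p.2)
  one_smul p := Prod.ext rfl (one_mul _)
  mul_smul g h p := Prod.ext rfl (by
    change (g * h).left (g.right (h.right p.1)) * p.2 =
      g.left (g.right (h.right p.1)) * (h.left (h.right p.1) * p.2)
    rw [mul_left_apply, Perm.inv_def, symm_apply_apply, mul_assoc])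

lemma smul_mk (g : SignedPerm V) (v : V) (a : ℤˣ) :
    g • (v, a) = (g.right v, g.left (g.right v) * a) := rfl

variable [DecidableEq V]

/-- The reflection exchanging the coordinates `i` and `j` up to the sign `a`. -/
def pairReflection (i j : V) (a : ℤˣ) : SignedPerm V :=
  ⟨Pi.mulSingle i a * Pi.mulSingle j a, swap i j⟩

/-- The diagonal reflection changing the sign of the coordinate `i`. -/
def signChange (i : V) : SignedPerm V := ⟨Pi.mulSingle i (-1), 1⟩

@[simp] lemma pairReflection_right (i j : V) (a : ℤˣ) :
    (pairReflection i j a).right = swap i j := rfl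

@[simp] lemma pairReflection_left (i j : V) (a : ℤˣ) :
    (pairReflection i j a).left = Pi.mulSingle i a * Pi.mulSingle j a := rfl

@[simp] lemma signChange_right (i : V) : (signChange i).right = 1 := rfl

@[simp] lemma signChange_left (i : V) : (signChange i).left = Pi.mulSingle i (-1) := rfl

/-- The reflections of the hyperoctahedral group. -/
def IsReflection (g : SignedPerm V) : Prop :=
  (∃ i j a, i ≠ j ∧ g = pairReflection i j a) ∨ ∃ i, g = signChange i

lemma pairReflection_comm (i j : V) (a : ℤˣ) : pairReflection i j a = pairReflection j i a := by
  rw [pairReflection, pairReflection, mul_comm, swap_comm]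

lemma pairReflection_mul_self {i j : V} (h : i ≠ j) (a : ℤˣ) :
    pairReflection i j a * pairReflection i j a = 1 := by
  apply SemidirectProduct.ext
  · funext v
    by_cases hi : v = i
    · subst hi; simp [mul_left_apply, -SemidirectProduct.mul_left, h, h.symm]
    · by_cases hj : v = j
      · subst hj; simp [mul_left_apply, -SemidirectProduct.mul_left, h, h.symm]
      · simp [mul_left_apply, -SemidirectProduct.mul_left, hi, hj, swap_apply_of_ne_of_ne hi hj]
  · simp

lemma signChange_mul_self (i : V) : signChange i * signChange i = 1 := by
  apply SemidirectProduct.ext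
  · funext v
    by_cases hi : v = i <;> simp [mul_left_apply, -SemidirectProduct.mul_left, hi]
  · simp

lemma mul_signChange (g : SignedPerm V) (i : V) :
    g * signChange i = signChange (g.right i) * g := by
  apply SemidirectProduct.ext
  · funext v
    simp [mul_left_apply, -SemidirectProduct.mul_left, Pi.mulSingle_apply, Equiv.symm_apply_eq,
      mul_comm]
  · simp

lemma mul_pairReflection (g : SignedPerm V) {i j : V} (h : i ≠ j) (a : ℤˣ) :
    g * pairReflection i j a =
      pairReflection (g.right i) (g.right j)
        (a * g.left (g.right i) * g.left (g.right j)) * g := by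
  apply SemidirectProduct.ext
  · funext v
    obtain ⟨v, rfl⟩ := g.right.surjective v
    have key : ∀ x y : ℤˣ, x * a = a * x * y * y := fun x y => by
      rw [mul_assoc, Int.units_mul_self, mul_one, mul_comm]
    have key' : ∀ x y : ℤˣ, x * a = a * y * x * y := fun x y => by
      rw [mul_right_comm a y x, key]
    by_cases hi : v = i
    · subst hi
      simpa [mul_left_apply, -SemidirectProduct.mul_left, h] using key _ _
    · by_cases hj : v = j
      · subst hj
        simpa [mul_left_apply, -SemidirectProduct.mul_left, h.symm] using key' _ _
      · simp [mul_left_apply, -SemidirectProduct.mul_left, hi, hj, swap_apply_of_ne_of_ne]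
  · simp [mul_swap_eq_swap_mul]

lemma pairReflection_eq_iff {i j i' j' : V} {a b : ℤˣ} (h : i ≠ j)
    (he : pairReflection i j a = pairReflection i' j' b) :
    ((i = i' ∧ j = j') ∨ (i = j' ∧ j = i')) ∧ a = b := by
  have hr : swap i j = swap i' j' := congrArg SemidirectProduct.right he
  have hl : (Pi.mulSingle i a * Pi.mulSingle j a : V → ℤˣ) =
      Pi.mulSingle i' b * Pi.mulSingle j' b :=
    congrArg SemidirectProduct.left he
  have h1 : j = swap i' j' i := by rw [← hr, swap_apply_left]
  have h2 := congrFun hl i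
  by_cases hi : i = i'
  · subst hi
    rw [swap_apply_left] at h1
    subst h1
    simpa [Pi.mulSingle_apply, h] using h2
  · by_cases hj : i = j'
    · subst hj
      rw [swap_apply_right] at h1
      subst h1
      simpa [Pi.mulSingle_apply, h] using h2
    · rw [swap_apply_of_ne_of_ne hi hj] at h1
      exact absurd h1.symm h

lemma signChange_injective : Function.Injective (signChange : V → SignedPerm V) := by
  intro i j h
  by_contra hij
  have := congrFun (congrArg SemidirectProduct.left h) i
  simp [hij] at this

lemma pairReflection_ne_signChange {i j k : V} (h : i ≠ j) (a : ℤˣ) :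
    pairReflection i j a ≠ signChange k := by
  intro he
  have : swap i j = 1 := congrArg SemidirectProduct.right he
  exact h (swap_eq_one_iff.1 this)

variable [Fintype V]

lemma closure_eq_top_of_isRootedForest {H : Subgroup (SignedPerm V)} {r : V} {f : V → V}
    (hf : IsRootedForest {r} (Finset.univ.erase r) f) (s : V → ℤˣ) (hr : signChange r ∈ H)
    (hs : ∀ v ≠ r, pairReflection v (f v) (s v) ∈ H) : H = ⊤ := by
  have hne : ∀ v ≠ r, v ≠ f v := fun v hv => (hf.apply_ne (by simpa using hv)).symm
  have hd : ∀ v, signChange v ∈ H := by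
    by_contra! hex
    obtain ⟨v₀, hv₀⟩ := hex
    classical
    obtain ⟨v, hv, hfv⟩ := hf.2.2 (Finset.univ.filter fun v => signChange v ∉ H)
      (fun v hv => by
        simp only [Finset.mem_filter, Finset.mem_univ, true_and, Finset.mem_erase, and_true] at hv ⊢
        rintro rfl
        exact hv hr) ⟨v₀, by simpa using hv₀⟩
    simp only [Finset.mem_filter, Finset.mem_univ, true_and, not_not] at hv hfv
    have hvr : v ≠ r := by rintro rfl; exact hv hr
    have h1 := mul_signChange (pairReflection v (f v) (s v)) (f v)
    rw [pairReflection_right, swap_apply_right, ← mul_inv_eq_iff_eq_mul] at h1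
    exact hv (h1 ▸ mul_mem (mul_mem (hs v hvr) hfv) (inv_mem (hs v hvr)))
  have hl : ∀ ε : V → ℤˣ, SemidirectProduct.inl ε ∈ H := by
    intro ε
    have : ε ∈ H.comap (SemidirectProduct.inl : _ →* SignedPerm V) := by
      refine Subgroup.pi_mem_of_mulSingle_mem ε fun v => ?_
      rcases Int.units_eq_one_or (ε v) with h | h <;> rw [h]
      · rw [Pi.mulSingle_one]
        exact one_mem _
      · exact hd v
    exact this
  have hsw : ∀ v ≠ r, swap v (f v) ∈ H.comap (SemidirectProduct.inr : _ →* SignedPerm V) := by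
    intro v hv
    have h1 : (SemidirectProduct.inr (swap v (f v)) : SignedPerm V) =
        (SemidirectProduct.inl (Pi.mulSingle v (s v) * Pi.mulSingle (f v) (s v)))⁻¹ *
          pairReflection v (f v) (s v) := by
      rw [eq_inv_mul_iff_mul_eq, ← SemidirectProduct.mk_eq_inl_mul_inr]
      rfl
    rw [Subgroup.mem_comap, h1]
    exact mul_mem (inv_mem (hl _)) (hs v hv)
  have hswr : ∀ v, swap v r ∈ H.comap (SemidirectProduct.inr : _ →* SignedPerm V) := by
    by_contra! hex
    obtain ⟨v₀, hv₀⟩ := hex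
    classical
    have hrr : swap r r ∈ H.comap (SemidirectProduct.inr : _ →* SignedPerm V) := by
      rw [swap_self]
      exact one_mem _
    obtain ⟨v, hv, hfv⟩ := hf.2.2 (Finset.univ.filter fun v => swap v r ∉
        H.comap (SemidirectProduct.inr : _ →* SignedPerm V))
      (fun v hv => by
        rw [Finset.mem_filter] at hv
        rw [Finset.mem_erase]
        refine ⟨?_, Finset.mem_univ _⟩
        rintro rfl
        exact hv.2 hrr) ⟨v₀, by rw [Finset.mem_filter]; exact ⟨Finset.mem_univ _, hv₀⟩⟩
    rw [Finset.mem_filter] at hv hfv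
    replace hv := hv.2
    replace hfv := not_not.1 fun h => hfv ⟨Finset.mem_univ _, h⟩
    have hvr : v ≠ r := by rintro rfl; exact hv hrr
    by_cases hfr : f v = r
    · exact hv (hfr ▸ hsw v hvr)
    · have h1 := swap_mul_swap_mul_swap (Ne.symm hfr) hvr.symm
      rw [swap_comm (f v) v, swap_comm r (f v)] at h1
      exact hv (h1 ▸ mul_mem (mul_mem (hsw v hvr) hfv) (hsw v hvr))
  have hr : ∀ σ, SemidirectProduct.inr σ ∈ H := by
    have htop : H.comap (SemidirectProduct.inr : _ →* SignedPerm V) = ⊤ := by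
      rw [eq_top_iff, ← Perm.closure_isSwap, Subgroup.closure_le]
      rintro _ ⟨x, y, hxy, rfl⟩
      by_cases hx : x = r
      · rw [hx, swap_comm]; exact hswr y
      by_cases hy : y = r
      · rw [hy]; exact hswr x
      rw [SetLike.mem_coe, swap_comm, ← swap_mul_swap_mul_swap hx hxy, swap_comm r y]
      exact mul_mem (mul_mem (hswr y) (hswr x)) (hswr y)
    intro σ
    exact Subgroup.mem_comap.1 (htop ▸ Subgroup.mem_top σ)
  rw [eq_top_iff]
  intro g _
  rw [← SemidirectProduct.inl_left_mul_inr_right g]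
  exact mul_mem (hl _) (hr _)

/-- Sets of `|V|` reflections generating the hyperoctahedral group. -/
def IsGoodSet (S : Finset (SignedPerm V)) : Prop :=
  S.card = Fintype.card V ∧ (∀ t ∈ S, IsReflection t) ∧
    Subgroup.closure (S : Set (SignedPerm V)) = ⊤

/-- The reflection attached to a vertex of a tree with root `r`, parent function `f` and edge
signs `s`. -/
def treeReflection (r : V) (f : V → V) (s : {v // v ≠ r} → ℤˣ) (v : V) : SignedPerm V :=
  if h : v = r then signChange r else pairReflection v (f v) (s ⟨v, h⟩)

omit [Fintype V] in
@[simp] lemma treeReflection_root (r : V) (f : V → V) (s : {v // v ≠ r} → ℤˣ) :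
    treeReflection r f s r = signChange r := by simp [treeReflection]

omit [Fintype V] in
lemma treeReflection_of_ne {r : V} (f : V → V) (s : {v // v ≠ r} → ℤˣ) {v : V} (h : v ≠ r) :
    treeReflection r f s v = pairReflection v (f v) (s ⟨v, h⟩) := by simp [treeReflection, h]

section Tree

variable {r : V} {f : V → V} (hf : IsRootedForest {r} (Finset.univ.erase r) f)
  (s : {v // v ≠ r} → ℤˣ)
include hf

lemma ne_parent {v : V} (hv : v ≠ r) : v ≠ f v := (hf.apply_ne (by simpa using hv)).symm

lemma treeReflection_injective : Function.Injective (treeReflection r f s) := by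
  intro v w h
  by_cases hv : v = r <;> by_cases hw : w = r
  · rw [hv, hw]
  · rw [hv, treeReflection_root, treeReflection_of_ne _ _ hw] at h
    exact absurd h.symm (pairReflection_ne_signChange (ne_parent hf hw) _)
  · rw [hw, treeReflection_root, treeReflection_of_ne _ _ hv] at h
    exact absurd h (pairReflection_ne_signChange (ne_parent hf hv) _)
  · rw [treeReflection_of_ne _ _ hv, treeReflection_of_ne _ _ hw] at h
    rcases (pairReflection_eq_iff (ne_parent hf hv) h).1 with h | ⟨h1, h2⟩
    · exact h.1
    · refine absurd ?_ (hf.apply_apply_ne (v := v) (by simpa using hv) (by simpa [h2] using hw))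
      rw [h2, h1]

lemma isGoodSet_image : IsGoodSet (Finset.univ.image (treeReflection r f s)) := by
  refine ⟨?_, fun t ht => ?_, ?_⟩
  · rw [Finset.card_image_of_injective _ (treeReflection_injective hf s), Finset.card_univ]
  · obtain ⟨v, -, rfl⟩ := Finset.mem_image.1 ht
    by_cases hv : v = r
    · exact Or.inr ⟨r, by rw [hv, treeReflection_root]⟩
    · exact Or.inl ⟨v, f v, s ⟨v, hv⟩, ne_parent hf hv, treeReflection_of_ne f s hv⟩
  · have hmem : ∀ v, treeReflection r f s v ∈
        Subgroup.closure (Finset.univ.image (treeReflection r f s) : Set (SignedPerm V)) :=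
      fun v => Subgroup.subset_closure (by simp)
    refine closure_eq_top_of_isRootedForest hf (fun v => if h : v ≠ r then s ⟨v, h⟩ else 1)
      (by simpa using hmem r) fun v hv => ?_
    simpa [hv, treeReflection_of_ne] using hmem v

lemma parent_parent_ne {f' : V → V} {s' : {v // v ≠ r} → ℤˣ}
    (h : ∀ v ≠ r, ∃ w ≠ r, treeReflection r f s v = treeReflection r f' s' w)
    {v : V} (hv : v ≠ r) (hfv : f v ≠ r) : f' (f v) ≠ v := by
  intro hv'
  obtain ⟨x, hx, hfx⟩ := hf.2.2 (Finset.univ.filter fun v => v ≠ r ∧ f v ≠ r ∧ f' (f v) = v)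
    (fun x hx => by simpa using (Finset.mem_filter.1 hx).2.1) ⟨v, by simp [hv, hfv, hv']⟩
  simp only [Finset.mem_filter, Finset.mem_univ, true_and] at hx hfx
  obtain ⟨hx, hxr, hx'⟩ := hx
  apply hfx
  obtain ⟨w, hw, he⟩ := h (f x) hxr
  rw [treeReflection_of_ne _ _ hxr, treeReflection_of_ne _ _ hw] at he
  rcases (pairReflection_eq_iff (ne_parent hf hxr) he).1 with ⟨rfl, h2⟩ | ⟨h1, h2⟩
  · rw [hx'] at h2
    exact absurd h2 (hf.apply_apply_ne (by simpa using hx) (by simpa using hxr))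
  · exact ⟨hxr, h2 ▸ hw, by rw [h2, ← h1]⟩

end Tree

variable (V) in
/-- Trees on `V` with a root and signed edges. -/
abbrev SignedTree : Type _ :=
  Σ r : V, {f : V → V // IsRootedForest {r} (Finset.univ.erase r) f} × ({v // v ≠ r} → ℤˣ)

/-- The good set of reflections attached to a signed tree. -/
def SignedTree.goodSet (T : SignedTree V) : {S : Finset (SignedPerm V) // IsGoodSet S} :=
  ⟨_, isGoodSet_image T.2.1.2 T.2.2⟩

lemma SignedTree.goodSet_injective :
    Function.Injective (SignedTree.goodSet : SignedTree V → _) := by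
  rintro ⟨r, ⟨f, hf⟩, s⟩ ⟨r', ⟨f', hf'⟩, s'⟩ h
  have himg : Finset.univ.image (treeReflection r f s) =
    Finset.univ.image (treeReflection r' f' s') := congrArg Subtype.val h
  have hex : ∀ v, ∃ w, treeReflection r f s v = treeReflection r' f' s' w := fun v => by
    have hv : treeReflection r f s v ∈ Finset.univ.image (treeReflection r f s) := by simp
    obtain ⟨w, -, hw⟩ := Finset.mem_image.1 (himg ▸ hv)
    exact ⟨w, hw.symm⟩
  obtain rfl : r = r' := by
    obtain ⟨w, hw⟩ := hex r
    rw [treeReflection_root] at hw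
    by_cases hwr : w = r'
    · rw [hwr, treeReflection_root] at hw
      exact signChange_injective hw
    · rw [treeReflection_of_ne _ _ hwr] at hw
      exact absurd hw.symm (pairReflection_ne_signChange (ne_parent hf' hwr) _)
  have hex' : ∀ v ≠ r, ∃ w ≠ r, treeReflection r f s v = treeReflection r f' s' w := by
    intro v hv
    obtain ⟨w, hw⟩ := hex v
    refine ⟨w, ?_, hw⟩
    rintro rfl
    rw [treeReflection_of_ne _ _ hv, treeReflection_root] at hw
    exact pairReflection_ne_signChange (ne_parent hf hv) _ hw
  have key : ∀ v (hv : v ≠ r), f v = f' v ∧ s ⟨v, hv⟩ = s' ⟨v, hv⟩ := by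
    intro v hv
    obtain ⟨w, hw, he⟩ := hex' v hv
    rw [treeReflection_of_ne _ _ hv, treeReflection_of_ne _ _ hw] at he
    obtain ⟨⟨rfl, h2⟩ | ⟨h1, h2⟩, h3⟩ := pairReflection_eq_iff (ne_parent hf hv) he
    · exact ⟨h2, h3⟩
    · exact absurd (by rw [h2, ← h1]) (parent_parent_ne hf s hex' hv (h2 ▸ hw))
  obtain rfl : f = f' := by
    ext v
    by_cases hv : v = r
    · rw [hf.1 v (by simp [hv]), hf'.1 v (by simp [hv])]
    · exact (key v hv).1
  obtain rfl : s = s' := by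
    ext ⟨v, hv⟩
    rw [(key v hv).2]
  rfl

/-- The graph whose edges are the pairs of coordinates exchanged by a reflection in `S`. -/
def reflectionGraph (S : Set (SignedPerm V)) : SimpleGraph V where
  Adj i j := i ≠ j ∧ ∃ a, pairReflection i j a ∈ S
  symm := ⟨fun i j ⟨h, a, ha⟩ => ⟨h.symm, a, pairReflection_comm i j a ▸ ha⟩⟩
  loopless := ⟨fun _ h => h.1 rfl⟩

omit [Fintype V] in
lemma reflectionGraph_reachable {S : Set (SignedPerm V)} (hS : ∀ t ∈ S, IsReflection t)
    (htop : Subgroup.closure S = ⊤) (i j : V) : (reflectionGraph S).Reachable i j := by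
  have h : ∀ g ∈ Subgroup.closure S, ∀ v, (reflectionGraph S).Reachable v (g.right v) := by
    intro g hg
    induction hg using Subgroup.closure_induction with
    | mem t ht =>
      intro v
      rcases hS t ht with ⟨i, j, a, hij, rfl⟩ | ⟨i, rfl⟩
      · have hadj : (reflectionGraph S).Adj i j := ⟨hij, a, ht⟩
        by_cases hi : v = i
        · subst hi
          simpa using hadj.reachable
        by_cases hj : v = j
        · subst hj
          simpa using hadj.symm.reachable
        simp [swap_apply_of_ne_of_ne hi hj]
      · simp
    | one => simp
    | mul g h _ _ ihg ihh => exact fun v => (ihh v).trans (ihg _)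
    | inv g _ ih =>
      intro v
      have := (ih (g.right⁻¹ v)).symm
      simpa using this
  simpa using h (SemidirectProduct.inr (swap i j)) (htop ▸ Subgroup.mem_top _) i

variable (V) in
/-- The product of the signs of a signed permutation. -/
def signProd : SignedPerm V →* ℤˣ where
  toFun g := ∏ v, g.left v
  map_one' := by simp
  map_mul' g h := by
    simp only [mul_left_apply, Finset.prod_mul_distrib]
    rw [Equiv.prod_comp g.right⁻¹ h.left]

lemma exists_signChange_mem [Nonempty V] {S : Set (SignedPerm V)}
    (hS : ∀ t ∈ S, IsReflection t) (htop : Subgroup.closure S = ⊤) : ∃ r, signChange r ∈ S := by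
  by_contra! hex
  have hle : Subgroup.closure S ≤ (signProd V).ker := by
    rw [Subgroup.closure_le]
    intro t ht
    rcases hS t ht with ⟨i, j, a, hij, rfl⟩ | ⟨i, rfl⟩
    · simp [signProd, MonoidHom.mem_ker, Finset.prod_mul_distrib, Finset.prod_pi_mulSingle']
    · exact absurd ht (hex i)
  have hmem : signChange (Classical.arbitrary V) ∈ (signProd V).ker :=
    hle (htop ▸ Subgroup.mem_top _)
  simp [signProd, MonoidHom.mem_ker, Finset.prod_pi_mulSingle'] at hmem

omit [DecidableEq V] [Fintype V] in
lemma _root_.SimpleGraph.Reachable.exists_adj_dist_lt {Γ : SimpleGraph V} {v r : V}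
    (h : Γ.Reachable v r) (hv : v ≠ r) : ∃ w, Γ.Adj v w ∧ Γ.dist w r < Γ.dist v r := by
  obtain ⟨p, hp⟩ := h.exists_walk_length_eq_dist
  cases p with
  | nil => exact absurd rfl hv
  | cons hadj q =>
    refine ⟨_, hadj, ?_⟩
    rw [← hp, SimpleGraph.Walk.length_cons]
    exact Nat.lt_succ_of_le (SimpleGraph.dist_le q)

lemma SignedTree.goodSet_surjective [Nonempty V] :
    Function.Surjective (SignedTree.goodSet : SignedTree V → _) := by
  rintro ⟨S, hcard, hS, htop⟩
  obtain ⟨r, hr⟩ := exists_signChange_mem hS htop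
  have hpar : ∀ v, ∃ w, (v = r → w = r) ∧ (v ≠ r → (reflectionGraph (S : Set _)).Adj v w ∧
      (reflectionGraph (S : Set _)).dist w r < (reflectionGraph (S : Set _)).dist v r) := by
    intro v
    by_cases hv : v = r
    · exact ⟨r, fun _ => rfl, fun h => absurd hv h⟩
    · obtain ⟨w, hw⟩ := (reflectionGraph_reachable hS htop v r).exists_adj_dist_lt hv
      exact ⟨w, fun h => absurd h hv, fun _ => hw⟩
  choose f hfr hf using hpar
  have hforest : IsRootedForest {r} (Finset.univ.erase r) f := by
    refine ⟨fun v hv => ?_, fun v _ => ?_, fun X hX hne => ?_⟩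
    · obtain rfl : v = r := by simpa using hv
      exact hfr v rfl
    · simp
    · obtain ⟨v, hv, hmin⟩ := X.exists_min_image
        (fun v => (reflectionGraph (S : Set _)).dist v r) hne
      refine ⟨v, hv, fun hfv => ?_⟩
      exact absurd (hmin _ hfv) (not_le.2 (hf v (Finset.ne_of_mem_erase (hX hv))).2)
  choose s hs using fun v : {v // v ≠ r} => (hf v v.2).1.2
  refine ⟨⟨r, ⟨f, hforest⟩, s⟩, Subtype.ext ?_⟩
  refine Finset.eq_of_subset_of_card_le (Finset.image_subset_iff.2 fun v _ => ?_) ?_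
  · by_cases hv : v = r
    · rw [hv, treeReflection_root]
      exact hr
    · rw [treeReflection_of_ne _ _ hv]
      exact hs ⟨v, hv⟩
  · rw [hcard]
    exact (isGoodSet_image hforest s).1.ge

/-- The number of good generating sets of reflections of the hyperoctahedral group. -/
theorem card_isGoodSet [Nonempty V] :
    Nat.card {S : Finset (SignedPerm V) // IsGoodSet S} =
      (2 * Fintype.card V) ^ (Fintype.card V - 1) := by
  classical
  rw [← Nat.card_congr (Equiv.ofBijective _
    ⟨SignedTree.goodSet_injective (V := V), SignedTree.goodSet_surjective⟩), Nat.card_sigma]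
  have h : ∀ r : V, Nat.card ({f : V → V // IsRootedForest {r} (Finset.univ.erase r) f} ×
      ({v // v ≠ r} → ℤˣ)) * Fintype.card V =
      Fintype.card V ^ (Fintype.card V - 1) * 2 ^ (Fintype.card V - 1) := by
    intro r
    rw [Nat.card_prod, ← IsRootedForest.card_tree_mul r, Nat.card_fun]
    simp
    ring
  apply Nat.eq_of_mul_eq_mul_right (Fintype.card_pos (α := V))
  rw [Finset.sum_mul, Finset.sum_congr rfl fun r _ => h r]
  simp
  ring

end SignedPerm

section Involutions

variable {G : Type*} [Group G] {a b : G} (ha : a * a = 1) (hb : b * b = 1)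
include ha hb

lemma mul_pow_two_eq_one_iff_of_involutions : (a * b) ^ 2 = 1 ↔ a * b = b * a := by
  rw [pow_two, mul_eq_one_iff_eq_inv, mul_inv_rev, inv_eq_of_mul_eq_one_left ha,
    inv_eq_of_mul_eq_one_left hb]

lemma mul_pow_three_eq_one_iff_of_involutions : (a * b) ^ 3 = 1 ↔ a * b * a = b * a * b := by
  rw [show (a * b) ^ 3 = (a * b * a) * (b * a * b) by simp only [pow_succ, pow_zero, one_mul,
    mul_assoc], mul_eq_one_iff_eq_inv, mul_inv_rev, mul_inv_rev, inv_eq_of_mul_eq_one_left ha,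
    inv_eq_of_mul_eq_one_left hb, mul_assoc b]

lemma mul_pow_four_eq_one_iff_of_involutions :
    (a * b) ^ 4 = 1 ↔ a * b * a * b = b * a * b * a := by
  rw [show (a * b) ^ 4 = (a * b * a * b) * (a * b * a * b) by simp only [pow_succ, pow_zero,
    one_mul, mul_assoc], mul_eq_one_iff_eq_inv, mul_inv_rev, mul_inv_rev, mul_inv_rev,
    inv_eq_of_mul_eq_one_left ha, inv_eq_of_mul_eq_one_left hb]
  simp only [mul_assoc]

lemma mul_pow_eq_one_comm_of_involutions {k : ℕ} (h : (a * b) ^ k = 1) : (b * a) ^ k = 1 := by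
  rw [show b * a = (a * b)⁻¹ by rw [mul_inv_rev, inv_eq_of_mul_eq_one_left ha,
    inv_eq_of_mul_eq_one_left hb], inv_pow, h, inv_one]

end Involutions

namespace CoxeterMatrix

lemma B_apply_of_lt {n : ℕ} {i j : Fin n} (h : i < j) :
    CoxeterMatrix.B n i j =
      if (j : ℕ) = i + 1 then (if (j : ℕ) + 1 = n then 4 else 3) else 2 := by
  have h1 : i ≠ j := h.ne
  have h2 : (i : ℕ) < j := h
  have h3 := j.2
  simp only [CoxeterMatrix.B, Matrix.of_apply, h1, if_false]
  split_ifs <;> omega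

end CoxeterMatrix

namespace SignedPerm

open Equiv

/-- The standard generators of the hyperoctahedral group. -/
def simpleReflection (n : ℕ) (i : Fin n) : SignedPerm (Fin n) :=
  if h : (i : ℕ) + 1 < n then pairReflection i ⟨i + 1, h⟩ 1 else signChange i

variable {n : ℕ}

lemma simpleReflection_of_lt {i : Fin n} (h : (i : ℕ) + 1 < n) :
    simpleReflection n i = pairReflection i ⟨i + 1, h⟩ 1 := dif_pos h

lemma simpleReflection_of_eq {i : Fin n} (h : (i : ℕ) + 1 = n) :
    simpleReflection n i = signChange i := dif_neg (by omega)

lemma simpleReflection_isReflection (i : Fin n) : IsReflection (simpleReflection n i) := by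
  unfold simpleReflection
  split_ifs with h
  · exact Or.inl ⟨_, _, _, by simp [Fin.ext_iff], rfl⟩
  · exact Or.inr ⟨i, rfl⟩

lemma IsReflection.mul_self {V : Type*} [DecidableEq V] {t : SignedPerm V} (h : IsReflection t) :
    t * t = 1 := by
  rcases h with ⟨i, j, a, hij, rfl⟩ | ⟨i, rfl⟩
  · exact pairReflection_mul_self hij a
  · exact signChange_mul_self i

lemma IsReflection.conj {V : Type*} [DecidableEq V] {t : SignedPerm V} (h : IsReflection t)
    (g : SignedPerm V) : IsReflection (g * t * g⁻¹) := by
  rcases h with ⟨i, j, a, hij, rfl⟩ | ⟨i, rfl⟩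
  · exact Or.inl ⟨_, _, _, g.right.injective.ne hij,
      by rw [mul_pairReflection g hij, mul_inv_cancel_right]⟩
  · exact Or.inr ⟨_, by rw [mul_signChange, mul_inv_cancel_right]⟩

lemma simpleReflection_isLiftable : (CoxeterMatrix.B n).IsLiftable (simpleReflection n) := by
  have hsq := fun i : Fin n => (simpleReflection_isReflection i).mul_self
  have hlt : ∀ i j : Fin n, i < j →
      (simpleReflection n i * simpleReflection n j) ^ CoxeterMatrix.B n i j = 1 := by
    intro i j hij
    have hij' : (i : ℕ) < j := hij
    have hi : (i : ℕ) + 1 < n := by omega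
    rw [CoxeterMatrix.B_apply_of_lt hij]
    split_ifs with h1 h2
    · rw [mul_pow_four_eq_one_iff_of_involutions (hsq i) (hsq j)]
      have hj : (⟨i + 1, hi⟩ : Fin n) = j := Fin.ext h1.symm
      have h3 := mul_signChange (simpleReflection n i) j
      have h4 := mul_signChange (signChange j) i
      rw [simpleReflection_of_eq h2]
      rw [simpleReflection_of_lt hi, hj] at h3 ⊢
      rw [pairReflection_right, swap_apply_right] at h3
      rw [signChange_right, Perm.one_apply] at h4
      have hs := pairReflection_mul_self hij.ne 1
      rw [h3, mul_assoc _ _ (pairReflection i j 1), hs, mul_one, ← h4, mul_assoc, mul_assoc,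
        ← mul_assoc (pairReflection i j 1), h3, mul_assoc, hs, mul_one]
    · rw [mul_pow_three_eq_one_iff_of_involutions (hsq i) (hsq j)]
      have hj : (⟨i + 1, hi⟩ : Fin n) = j := Fin.ext h1.symm
      have hjn : (j : ℕ) + 1 < n := by omega
      rw [simpleReflection_of_lt hi, hj, simpleReflection_of_lt hjn]
      set k : Fin n := ⟨j + 1, hjn⟩ with hk
      have hjk : j ≠ k := by simp [hk, Fin.ext_iff]
      have hik : i ≠ k := by rw [hk, Ne, Fin.ext_iff]; simp only; omega
      have h3 := mul_pairReflection (pairReflection i j 1) hjk 1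
      have h4 := mul_pairReflection (pairReflection j k 1) hij.ne 1
      simp [swap_apply_of_ne_of_ne hik.symm hjk.symm] at h3
      simp [swap_apply_of_ne_of_ne hij.ne hik] at h4
      rw [h3, h4, mul_assoc, mul_assoc, pairReflection_mul_self hij.ne,
        pairReflection_mul_self hjk]
    · rw [mul_pow_two_eq_one_iff_of_involutions (hsq i) (hsq j)]
      have hne : j ≠ ⟨i + 1, hi⟩ := by rw [Ne, Fin.ext_iff]; exact h1
      rw [simpleReflection_of_lt hi]
      by_cases hjn : (j : ℕ) + 1 < n
      · have hki : (⟨j + 1, hjn⟩ : Fin n) ≠ i := by rw [Ne, Fin.ext_iff]; simp only; omega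
        have hki' : (⟨j + 1, hjn⟩ : Fin n) ≠ ⟨i + 1, hi⟩ := by
          rw [Ne, Fin.ext_iff]; simp only; omega
        rw [simpleReflection_of_lt hjn, mul_pairReflection _ (by simp [Fin.ext_iff])]
        simp [swap_apply_of_ne_of_ne hij.ne' hne, swap_apply_of_ne_of_ne hki hki']
      · rw [simpleReflection_of_eq (by omega), mul_signChange]
        simp [swap_apply_of_ne_of_ne hij.ne' hne]
  intro i j
  rcases lt_trichotomy i j with h | rfl | h
  · exact hlt i j h
  · simp [hsq]
  · rw [CoxeterMatrix.symmetric]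
    exact mul_pow_eq_one_comm_of_involutions (hsq j) (hsq i) (hlt j i h)

/-- The canonical homomorphism from the Coxeter group of type `B` to signed permutations. -/
def ofCoxeterGroup (n : ℕ) : (CoxeterMatrix.B n).Group →* SignedPerm (Fin n) :=
  (CoxeterMatrix.B n).toCoxeterSystem.lift ⟨simpleReflection n, simpleReflection_isLiftable⟩

lemma ofCoxeterGroup_simple (i : Fin n) :
    ofCoxeterGroup n ((CoxeterMatrix.B n).toCoxeterSystem.simple i) = simpleReflection n i :=
  CoxeterSystem.lift_apply_simple _ _ i

lemma ofCoxeterGroup_surjective (m : ℕ) : Function.Surjective (ofCoxeterGroup (m + 1)) := by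
  rw [← MonoidHom.range_eq_top]
  have hmem : ∀ i, simpleReflection (m + 1) i ∈ (ofCoxeterGroup (m + 1)).range := fun i =>
    ⟨_, ofCoxeterGroup_simple i⟩
  have hlt : ∀ i ≠ Fin.last m, (i : ℕ) + 1 < m + 1 := fun i hi => by
    have := Fin.val_lt_last hi
    omega
  let f : Fin (m + 1) → Fin (m + 1) := fun i =>
    if h : (i : ℕ) + 1 < m + 1 then ⟨i + 1, h⟩ else i
  have hf : ∀ i (hi : i ≠ Fin.last m), f i = ⟨i + 1, hlt i hi⟩ := fun i hi => dif_pos (hlt i hi)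
  refine closure_eq_top_of_isRootedForest (r := Fin.last m) (f := f) ⟨fun v hv => ?_, fun v _ => ?_,
    fun X hX hne => ?_⟩ 1 ?_ fun v hv => ?_
  · obtain rfl : v = Fin.last m := by simpa using hv
    simp [f]
  · simp
  · obtain ⟨x, hx, hmax⟩ := X.exists_max_image id hne
    refine ⟨x, hx, fun h => ?_⟩
    have h1 : f x ≤ x := hmax _ h
    rw [hf x (Finset.ne_of_mem_erase (hX hx)), Fin.le_def] at h1
    simp at h1
  · rw [← simpleReflection_of_eq (by simp)]
    exact hmem _
  · rw [hf v hv, Pi.one_apply, ← simpleReflection_of_lt]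
    exact hmem v

/-- The simple reflections of the Coxeter group of type `B`, numbered from the double bond. -/
def revSimple (m i : ℕ) : (CoxeterMatrix.B (m + 1)).Group :=
  (CoxeterMatrix.B (m + 1)).toCoxeterSystem.simple ⟨m - i, by omega⟩

lemma braidRelationsB_revSimple (m : ℕ) : BraidRelationsB (m + 1) (revSimple m) := by
  have hsq : ∀ i, revSimple m i * revSimple m i = 1 :=
    fun i => CoxeterSystem.simple_mul_simple_self _ _
  have hpow : ∀ i j k, i < j → j < m + 1 →
      (if m - i = m - j + 1 then (if i = 0 then 4 else 3) else 2) = k →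
      (revSimple m j * revSimple m i) ^ k = 1 := by
    rintro i j k hij hj rfl
    have := (CoxeterMatrix.B (m + 1)).toCoxeterSystem.simple_mul_simple_pow
      ⟨m - j, by omega⟩ ⟨m - i, by omega⟩
    rw [CoxeterMatrix.B_apply_of_lt (Fin.mk_lt_mk.2 (by omega))] at this
    have h0 : m - i + 1 = m + 1 ↔ i = 0 := by omega
    simpa only [h0, revSimple] using this
  refine ⟨fun i _ => hsq i, fun i j hij hj => ?_, fun i hi => ?_, fun hn => ?_⟩
  · exact ((mul_pow_two_eq_one_iff_of_involutions (hsq j) (hsq i)).1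
      (hpow i j 2 (by omega) hj (if_neg (by omega)))).symm
  · exact ((mul_pow_three_eq_one_iff_of_involutions (hsq _) (hsq _)).1
      (hpow (i + 1) (i + 2) 3 (by omega) hi (by rw [if_pos (by omega), if_neg (by omega)]))).symm
  · exact ((mul_pow_four_eq_one_iff_of_involutions (hsq _) (hsq _)).1
      (hpow 0 1 4 (by omega) hn (by rw [if_pos (by omega), if_pos rfl]))).symm

lemma closure_revSimple (m : ℕ) :
    Subgroup.closure (revSimple m '' Set.Iio (m + 1)) = ⊤ := by
  rw [← (CoxeterMatrix.B (m + 1)).toCoxeterSystem.subgroup_closure_range_simple]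
  congr 1
  ext w
  constructor
  · rintro ⟨i, -, rfl⟩
    exact ⟨_, rfl⟩
  · rintro ⟨i, rfl⟩
    refine ⟨m - i, by simp, ?_⟩
    unfold revSimple
    congr
    omega

lemma ofCoxeterGroup_injective (m : ℕ) : Function.Injective (ofCoxeterGroup (m + 1)) := by
  have hval : ∀ j k, j < m + 1 → k < m + 1 → (m - j = m - k ↔ j = k) := by omega
  have h0 : ofCoxeterGroup (m + 1) (revSimple m 0) = signChange ⟨m, by omega⟩ := by
    rw [revSimple, ofCoxeterGroup_simple, simpleReflection_of_eq (by simp)]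
    rfl
  have hs : ∀ i, i + 1 < m + 1 → ofCoxeterGroup (m + 1) (revSimple m (i + 1)) =
      pairReflection ⟨m - (i + 1), by omega⟩ ⟨m - i, by omega⟩ 1 := by
    intro i hi
    rw [revSimple, ofCoxeterGroup_simple, simpleReflection_of_lt (by simp only; omega)]
    congr 2
    simp only
    omega
  refine (braidRelationsB_revSimple m).injective_of_action (ofCoxeterGroup (m + 1))
    (closure_revSimple m) (e := fun j => ((⟨m - j, by omega⟩ : Fin (m + 1)), (1 : ℤˣ)))
    (e' := fun j => (⟨m - j, by omega⟩, (-1 : ℤˣ))) ?_ ?_ ?_ ?_ ?_ ?_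
  · rw [h0, smul_mk]
    simp
  · intro i hi
    rw [hs i hi, smul_mk]
    simp
  · intro i hi
    rw [hs i hi, smul_mk]
    simp
  · intro i k hik hk
    rcases i with _ | i
    · have hne : (⟨m - k, by omega⟩ : Fin (m + 1)) ≠ ⟨m, by omega⟩ := by
        rw [Ne, Fin.ext_iff]; simp only; omega
      rw [h0, smul_mk]
      simp [hne]
    · have hne : (⟨m - k, by omega⟩ : Fin (m + 1)) ≠ ⟨m - (i + 1), by omega⟩ := by
        rw [Ne, Fin.ext_iff]; simp only; omega
      have hne' : (⟨m - k, by omega⟩ : Fin (m + 1)) ≠ ⟨m - i, by omega⟩ := by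
        rw [Ne, Fin.ext_iff]; simp only; omega
      rw [hs i (by omega), smul_mk]
      simp [swap_apply_of_ne_of_ne hne hne']
  · intro j k hj hk h
    exact (hval j k hj hk).1 (by simpa using h)
  · intro j k hj hk h
    simp at h

/-- The Coxeter group of type `B` is the group of signed permutations. -/
noncomputable def coxeterGroupEquiv (m : ℕ) :
    (CoxeterMatrix.B (m + 1)).Group ≃* SignedPerm (Fin (m + 1)) :=
  MulEquiv.ofBijective _ ⟨ofCoxeterGroup_injective m, ofCoxeterGroup_surjective m⟩

lemma exists_perm_apply {V : Type*} [DecidableEq V] {a b i j : V} (hab : a ≠ b) (hij : i ≠ j) :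
    ∃ σ : Perm V, σ a = i ∧ σ b = j := by
  refine ⟨swap (swap a i b) j * swap a i, ?_, by simp⟩
  rw [Perm.mul_apply, swap_apply_left]
  refine swap_apply_of_ne_of_ne ?_ hij
  nth_rewrite 1 [← swap_apply_left a i]
  exact (swap a i).injective.ne hab

lemma IsReflection.exists_conj_simpleReflection {m : ℕ} {t : SignedPerm (Fin (m + 1))}
    (ht : IsReflection t) : ∃ g i, t = g * simpleReflection (m + 1) i * g⁻¹ := by
  rcases ht with ⟨i, j, a, hij, rfl⟩ | ⟨i, rfl⟩
  · have hm : 0 < m := by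
      by_contra h
      exact hij (Fin.ext (by omega))
    have h01 : (0 : Fin (m + 1)) ≠ ⟨1, by omega⟩ := by simp [Fin.ext_iff]
    obtain ⟨σ, rfl, rfl⟩ := exists_perm_apply h01 hij
    refine ⟨⟨Pi.mulSingle (σ 0) a, σ⟩, 0, ?_⟩
    rw [simpleReflection_of_lt (by simpa using hm), eq_mul_inv_iff_mul_eq]
    rw [mul_pairReflection _ (by simp [Fin.ext_iff])]
    simp [hij.symm]
  · refine ⟨SemidirectProduct.inr (swap (Fin.last m) i), Fin.last m, ?_⟩
    rw [simpleReflection_of_eq (by simp), eq_mul_inv_iff_mul_eq, mul_signChange]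
    simp

lemma isReflection_coxeterGroupEquiv_iff {m : ℕ} (t : (CoxeterMatrix.B (m + 1)).Group) :
    IsReflection (coxeterGroupEquiv m t) ↔
      (CoxeterMatrix.B (m + 1)).toCoxeterSystem.IsReflection t := by
  have hsimple : ∀ i, coxeterGroupEquiv m ((CoxeterMatrix.B (m + 1)).toCoxeterSystem.simple i) =
    simpleReflection (m + 1) i := ofCoxeterGroup_simple
  constructor
  · intro h
    obtain ⟨g, i, hg⟩ := h.exists_conj_simpleReflection
    refine ⟨(coxeterGroupEquiv m).symm g, i, (coxeterGroupEquiv m).injective ?_⟩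
    rw [hg, map_mul, map_mul, map_inv, hsimple, MulEquiv.apply_symm_apply]
  · rintro ⟨w, i, rfl⟩
    rw [map_mul, map_mul, map_inv, hsimple]
    exact (simpleReflection_isReflection i).conj _

end SignedPerm

/-- In the Weyl group of type `Bₙ` (the hyperoctahedral group, realized as the
Coxeter group of the Coxeter matrix of type `Bₙ`), the number of sets of `n`
reflections that generate the whole group is `(2n)^(n-1)`. -/
theorem stmt_17 (n : ℕ) (hn : 0 < n) :
    Nat.card {S : Finset (CoxeterMatrix.Bₙ n).Group //
        S.card = n ∧
        (∀ t ∈ S, (CoxeterMatrix.Bₙ n).toCoxeterSystem.IsReflection t) ∧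
        Subgroup.closure (S : Set (CoxeterMatrix.Bₙ n).Group) = ⊤}
      = (2 * n) ^ (n - 1) := by
  obtain ⟨m, rfl⟩ : ∃ m, n = m + 1 := ⟨n - 1, by omega⟩
  have h := SignedPerm.card_isGoodSet (V := Fin (m + 1))
  rw [Fintype.card_fin] at h
  rw [← h]
  refine Nat.card_congr ((SignedPerm.coxeterGroupEquiv m).toEquiv.finsetCongr.subtypeEquiv ?_)
  intro S
  rw [SignedPerm.IsGoodSet, Fintype.card_fin]
  refine and_congr ?_ (and_congr ?_ ?_)
  · rw [Equiv.finsetCongr_apply, Finset.card_map]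
    exact Iff.rfl
  · simp only [Equiv.finsetCongr_apply, Finset.forall_mem_map, Equiv.coe_toEmbedding,
      MulEquiv.toEquiv_eq_coe, MulEquiv.coe_toEquiv]
    exact forall₂_congr fun t _ => (SignedPerm.isReflection_coxeterGroupEquiv_iff t).symm
  · have hc := (SignedPerm.coxeterGroupEquiv m).toMonoidHom.map_closure (S : Set _)
    rw [Equiv.finsetCongr_apply, Finset.coe_map]
    refine Iff.trans ?_ (Eq.congr_left hc)
    rw [← Subgroup.map_equiv_top (SignedPerm.coxeterGroupEquiv m)]
    exact (Subgroup.map_injective (SignedPerm.coxeterGroupEquiv m).injective).eq_iff.symm
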